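/- Suppose ω is a modulus of continuity with limsup_{δ→0+} ω(δ)/√δ = ∞. Then there exist real-valued functions u, v ∈ Lip_ω(𝕋) such that for every homeomorphism h of the circle 𝕋 onto itself, at least one of u∘h, v∘h does not belong to W_2^{1/2}(𝕋). -/

import Mathlib

open Real MeasureTheory Filter

noncomputable section

instance : Fact (0 < 2 * Real.pi) := ⟨by positivity⟩

/-- A modulus of continuity: a nondecreasing continuous function `ω : [0,∞) → [0,∞)`
with `ω 0 = 0` and `ω (x+y) ≤ ω x + ω y`. -/
def IsModulusOfContinuity (ω : ℝ → ℝ) : Prop :=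
  ContinuousOn ω (Set.Ici 0) ∧ MonotoneOn ω (Set.Ici 0) ∧ ω 0 = 0 ∧
    (∀ x : ℝ, 0 ≤ x → 0 ≤ ω x) ∧
    ∀ x y : ℝ, 0 ≤ x → 0 ≤ y → ω (x + y) ≤ ω x + ω y

/-- The circle `ℝ / 2πℤ`. -/
abbrev Circ : Type := AddCircle (2 * Real.pi)

open AddCircle in
theorem fourierCoeff_comp_add_sub (f : C(Circ, ℂ)) (s : Circ) (k : ℤ) :
    fourierCoeff (fun t => f (t + s) - f t) k = (fourier k s - 1) * fourierCoeff f k := by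
  have hInt : ∀ g : C(Circ, ℂ), Integrable (fun t => fourier (-k) t • g t) haarAddCircle :=
    fun g => ((fourier (-k)).continuous.smul g.continuous).integrable_of_hasCompactSupport
      (HasCompactSupport.of_compactSpace _)
  have hshift : ∫ t, fourier (-k) t • f (t + s) ∂haarAddCircle
      = fourier k s * fourierCoeff f k := by
    have h1 : ∀ t : Circ, fourier (-k) t • f (t + s)
        = (fun x => fourier k s * (fourier (-k) x • f x)) (t + s) := by
      intro t
      have h2 : (fourier k s : ℂ) * fourier (-k) (t + s) = fourier (-k) t := by
        simp only [fourier_apply, ← Circle.coe_mul, ← toCircle_add]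
        congr 2
        simp
      simp only [smul_eq_mul]
      rw [← h2]
      ring
    simp_rw [h1]
    rw [integral_add_right_eq_self (μ := haarAddCircle)
      (fun x => fourier k s * (fourier (-k) x • f x)) s, integral_const_mul]
    rfl
  have h3 : fourierCoeff (fun t => f (t + s) - f t) k
      = ∫ t, (fourier (-k) t • f (t + s) - fourier (-k) t • f t) ∂haarAddCircle := by
    simp only [fourierCoeff, smul_sub]
  rw [h3, sub_mul, one_mul, ← hshift]
  exact integral_sub (hInt (f.comp ⟨fun t => t + s, by fun_prop⟩)) (hInt f)

open AddCircle in
theorem hasSum_sq_fourierCoeff_continuousMap (f : C(Circ, ℂ)) :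
    HasSum (fun k : ℤ => ‖fourierCoeff f k‖ ^ 2) (∫ t, ‖f t‖ ^ 2 ∂haarAddCircle) := by
  have h := hasSum_sq_fourierCoeff (f.toLp (E := ℂ) 2 haarAddCircle ℂ)
  simp_rw [fourierCoeff_toLp] at h
  convert h using 1
  refine integral_congr_ae ?_
  filter_upwards [ContinuousMap.coeFn_toLp (p := 2) haarAddCircle (𝕜 := ℂ) f] with t ht
  rw [ht]

open AddCircle in
theorem hasSum_conj_fourierCoeff_mul (f g : C(Circ, ℂ)) :
    HasSum (fun k : ℤ => (starRingEnd ℂ) (fourierCoeff f k) * fourierCoeff g k)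
      (∫ t, (starRingEnd ℂ) (f t) * g t ∂haarAddCircle) := by
  have h := fourierBasis.hasSum_inner_mul_inner (f.toLp (E := ℂ) 2 haarAddCircle ℂ)
    (g.toLp (E := ℂ) 2 haarAddCircle ℂ)
  have h1 : ∀ (φ : C(Circ, ℂ)) (k : ℤ),
      inner ℂ (fourierBasis k) (φ.toLp (E := ℂ) 2 haarAddCircle ℂ) = fourierCoeff φ k := by
    intro φ k
    rw [← fourierBasis.repr_apply_apply, fourierBasis_repr, fourierCoeff_toLp]
  have h2 : ∀ (φ : C(Circ, ℂ)) (k : ℤ),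
      inner ℂ (φ.toLp (E := ℂ) 2 haarAddCircle ℂ) (fourierBasis k)
        = (starRingEnd ℂ) (fourierCoeff φ k) := by
    intro φ k
    rw [← h1, inner_conj_symm]
  simp_rw [h1, h2] at h
  suffices h3 : ∫ t, (starRingEnd ℂ) (f t) * g t ∂haarAddCircle = inner ℂ
      (f.toLp (E := ℂ) 2 haarAddCircle ℂ) (g.toLp (E := ℂ) 2 haarAddCircle ℂ) by
    rw [h3]
    exact h
  rw [L2.inner_def]
  refine integral_congr_ae ?_
  filter_upwards [ContinuousMap.coeFn_toLp (p := 2) haarAddCircle (𝕜 := ℂ) f,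
    ContinuousMap.coeFn_toLp (p := 2) haarAddCircle (𝕜 := ℂ) g] with t ht hs
  rw [ht, hs, RCLike.inner_apply']

/-- The squared `L²` distance between `f` and its translate by `s`. -/
def sqDiff (f : C(Circ, ℂ)) (s : Circ) : ℝ :=
  ∫ t, ‖f (t + s) - f t‖ ^ 2 ∂AddCircle.haarAddCircle

theorem hasSum_sqDiff (f : C(Circ, ℂ)) (s : Circ) :
    HasSum (fun k : ℤ => ‖fourierCoeff f k‖ ^ 2 * ‖(fourier k s : ℂ) - 1‖ ^ 2) (sqDiff f s) := by
  have h := hasSum_sq_fourierCoeff_continuousMap (f.comp ⟨fun t => t + s, by fun_prop⟩ - f)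
  have h' : HasSum _ (sqDiff f s) := h
  convert h' using 1
  funext k
  rw [show (⇑(f.comp ⟨fun t => t + s, by fun_prop⟩ - f) : Circ → ℂ)
    = fun t => f (t + s) - f t from rfl, fourierCoeff_comp_add_sub f s k, norm_mul, mul_pow,
    mul_comm]

theorem norm_fourier_coe_sub_one (k : ℤ) (s : ℝ) :
    ‖(fourier k (s : Circ) : ℂ) - 1‖ = 2 * |Real.sin (k * s / 2)| := by
  rw [fourier_coe_apply]
  have : (2 * Real.pi * Complex.I * k * s / ((2 * Real.pi : ℝ) : ℂ) : ℂ)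
      = Complex.I * ((k * s : ℝ) : ℂ) := by
    have : (Real.pi : ℂ) ≠ 0 := by exact_mod_cast Real.pi_ne_zero
    push_cast
    field_simp
  rw [this, Complex.norm_exp_I_mul_ofReal_sub_one]
  simp

theorem norm_fourier_coe_sub_one_le (k : ℤ) (s : ℝ) :
    ‖(fourier k (s : Circ) : ℂ) - 1‖ ≤ |(k : ℝ)| * |s| := by
  rw [norm_fourier_coe_sub_one]
  have := Real.abs_sin_le_abs (x := k * s / 2)
  rw [abs_div, abs_mul, abs_two] at this
  linarith

theorem dyadic_term_le {x X : ℝ} (hx : 0 < x) (hX : 0 < X) {a : ℝ} (h4 : a ≤ 4)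
    (hxX : a ≤ (x / X) ^ 2) :
    X * a ≤ 12 * (x * (2 * X) / (x + 2 * X)) - 12 * (x * X / (x + X)) := by
  have h1 : 12 * (x * (2 * X) / (x + 2 * X)) - 12 * (x * X / (x + X))
      = X * (12 * x ^ 2 / ((x + 2 * X) * (x + X))) := by
    field_simp
    ring
  rw [h1]
  refine mul_le_mul_of_nonneg_left ?_ hX.le
  rw [le_div_iff₀ (by positivity)]
  rcases le_total (2 * X) x with h | h
  · have h2 : a * ((x + 2 * X) * (x + X)) ≤ 4 * ((x + 2 * X) * (x + X)) := by gcongr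
    nlinarith [mul_nonneg (sub_nonneg.2 h) hx.le, mul_nonneg (sub_nonneg.2 h) hX.le]
  · rw [div_pow, le_div_iff₀ (by positivity)] at hxX
    have h2 : (x + 2 * X) * (x + X) ≤ 12 * X ^ 2 := by nlinarith
    rcases le_total a 0 with h0 | h0
    · have : a * ((x + 2 * X) * (x + X)) ≤ 0 := mul_nonpos_of_nonpos_of_nonneg h0 (by positivity)
      nlinarith [sq_nonneg x]
    · nlinarith [mul_le_mul_of_nonneg_left h2 h0]

theorem sum_dyadic_le (k : ℤ) (n : ℕ) :
    ∑ j ∈ Finset.range n, 2 ^ j * ‖(fourier k (((1 / 2 ^ j : ℝ)) : Circ) : ℂ) - 1‖ ^ 2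
      ≤ 12 * |(k : ℝ)| := by
  rcases eq_or_ne k 0 with rfl | hk
  · simp
  have hx : 0 < |(k : ℝ)| := by positivity
  set x := |(k : ℝ)|
  have h1 : ∀ j : ℕ, 2 ^ j * ‖(fourier k (((1 / 2 ^ j : ℝ)) : Circ) : ℂ) - 1‖ ^ 2
      ≤ 12 * (x * 2 ^ (j + 1) / (x + 2 ^ (j + 1))) - 12 * (x * 2 ^ j / (x + 2 ^ j)) := by
    intro j
    rw [pow_succ' (2 : ℝ) j]
    refine dyadic_term_le hx (by positivity) ?_ ?_
    · have h2 : ‖(fourier k (((1 / 2 ^ j : ℝ)) : Circ) : ℂ) - 1‖ ≤ 2 := by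
        rw [norm_fourier_coe_sub_one]
        have := Real.abs_sin_le_one (k * (1 / 2 ^ j) / 2)
        linarith
      calc _ ≤ (2 : ℝ) ^ 2 := by gcongr
        _ = 4 := by norm_num
    · have h2 := norm_fourier_coe_sub_one_le k (1 / 2 ^ j)
      rw [abs_of_pos (show (0 : ℝ) < 1 / 2 ^ j by positivity), mul_one_div] at h2
      gcongr
  calc _ ≤ ∑ j ∈ Finset.range n, (12 * (x * 2 ^ (j + 1) / (x + 2 ^ (j + 1)))
          - 12 * (x * 2 ^ j / (x + 2 ^ j))) := Finset.sum_le_sum fun j _ => h1 j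
    _ = 12 * (x * 2 ^ n / (x + 2 ^ n)) - 12 * (x * 2 ^ 0 / (x + 2 ^ 0)) :=
        Finset.sum_range_sub (fun j => 12 * (x * 2 ^ j / (x + 2 ^ j))) n
    _ ≤ 12 * x - 0 := by
        gcongr
        · rw [div_le_iff₀ (by positivity)]
          nlinarith [sq_nonneg x]
        · positivity
    _ = 12 * x := by ring

theorem le_sum_dyadic (k : ℤ) {n : ℕ} (hn : k.natAbs < n) :
    |(k : ℝ)| ≤ 5 * ∑ j ∈ Finset.range n,
      2 ^ j * ‖(fourier k (((1 / 2 ^ j : ℝ)) : Circ) : ℂ) - 1‖ ^ 2 := by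
  rcases eq_or_ne k 0 with rfl | hk
  · simp
  have hk' : k.natAbs ≠ 0 := by simpa using hk
  set m := Nat.log 2 k.natAbs
  have hmn : m < n := (Nat.log_le_self 2 _).trans_lt hn
  have hlo : (2 : ℝ) ^ m ≤ |(k : ℝ)| := by
    have := Nat.pow_log_le_self 2 hk'
    rw [← Int.cast_abs, ← Nat.cast_natAbs]
    exact_mod_cast this
  have hhi : |(k : ℝ)| < 2 ^ (m + 1) := by
    have := Nat.lt_pow_succ_log_self (b := 2) (by norm_num) k.natAbs
    rw [← Int.cast_abs, ← Nat.cast_natAbs]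
    exact_mod_cast this
  have hterm : 2 / Real.pi ≤ ‖(fourier k (((1 / 2 ^ m : ℝ)) : Circ) : ℂ) - 1‖ := by
    rw [norm_fourier_coe_sub_one]
    have h1 : |(k : ℝ) * (1 / 2 ^ m) / 2| = |(k : ℝ)| / 2 ^ m / 2 := by
      rw [abs_div, abs_mul, abs_two, abs_of_pos (show (0 : ℝ) < 1 / 2 ^ m by positivity)]
      ring
    have h2 : 1 ≤ |(k : ℝ)| / 2 ^ m := by rwa [one_le_div (by positivity)]
    have h3 : |(k : ℝ)| / 2 ^ m ≤ 2 := by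
      rw [div_le_iff₀ (by positivity)]
      rw [pow_succ'] at hhi
      exact hhi.le
    have h4 := Real.mul_abs_le_abs_sin (x := (k : ℝ) * (1 / 2 ^ m) / 2)
      (by rw [h1]; linarith [Real.pi_gt_three])
    rw [h1] at h4
    have h5 : 2 / Real.pi * (1 / 2) ≤ 2 / Real.pi * (|(k : ℝ)| / 2 ^ m / 2) := by gcongr
    linarith
  have hpi : (2 : ℝ) / 5 ≤ (2 / Real.pi) ^ 2 := by
    rw [div_pow, le_div_iff₀ (by positivity)]
    nlinarith [Real.pi_lt_d2, Real.pi_pos]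
  calc |(k : ℝ)| ≤ 5 * (2 ^ m * (2 / 5)) := by rw [pow_succ'] at hhi; linarith
    _ ≤ 5 * (2 ^ m * ‖(fourier k (((1 / 2 ^ m : ℝ)) : Circ) : ℂ) - 1‖ ^ 2) := by
        have : (2 : ℝ) / 5 ≤ ‖(fourier k (((1 / 2 ^ m : ℝ)) : Circ) : ℂ) - 1‖ ^ 2 :=
          hpi.trans (by gcongr)
        gcongr
    _ ≤ _ := by
        gcongr
        exact Finset.single_le_sum
          (f := fun j => 2 ^ j * ‖(fourier k (((1 / 2 ^ j : ℝ)) : Circ) : ℂ) - 1‖ ^ 2)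
          (fun j _ => by positivity) (Finset.mem_range.2 hmn)

theorem sqDiff_mono {f g : C(Circ, ℂ)} (hfg : ∀ s t, ‖g s - g t‖ ≤ ‖f s - f t‖) (s : Circ) :
    sqDiff g s ≤ sqDiff f s := by
  have hInt : ∀ φ : C(Circ, ℂ),
      Integrable (fun t => ‖φ (t + s) - φ t‖ ^ 2) AddCircle.haarAddCircle := fun φ =>
    (show Continuous fun t => ‖φ (t + s) - φ t‖ ^ 2 by fun_prop).integrable_of_hasCompactSupport
      (HasCompactSupport.of_compactSpace _)
  refine integral_mono (hInt g) (hInt f) fun t => ?_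
  have := hfg (t + s) t
  dsimp only
  gcongr

/-- Maps contracting increments are bounded on `W_2^{1/2}`. -/
theorem sum_sq_fourierCoeff_mul_abs_le {f g : C(Circ, ℂ)}
    (hfg : ∀ s t, ‖g s - g t‖ ≤ ‖f s - f t‖)
    (hf : Summable fun k : ℤ => ‖fourierCoeff f k‖ ^ 2 * |(k : ℝ)|) (K : Finset ℤ) :
    ∑ k ∈ K, ‖fourierCoeff g k‖ ^ 2 * |(k : ℝ)|
      ≤ 60 * ∑' k : ℤ, ‖fourierCoeff f k‖ ^ 2 * |(k : ℝ)| := by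
  set n := K.sup Int.natAbs + 1
  set A : ℤ → ℝ := fun k => ∑ j ∈ Finset.range n,
    2 ^ j * ‖(fourier k (((1 / 2 ^ j : ℝ)) : Circ) : ℂ) - 1‖ ^ 2
  have hS : ∀ φ : C(Circ, ℂ), HasSum (fun k : ℤ => ‖fourierCoeff φ k‖ ^ 2 * A k)
      (∑ j ∈ Finset.range n, 2 ^ j * sqDiff φ ((1 / 2 ^ j : ℝ) : Circ)) := by
    intro φ
    have h0 : (fun k : ℤ => ‖fourierCoeff φ k‖ ^ 2 * A k) = fun k => ∑ j ∈ Finset.range n,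
        2 ^ j * (‖fourierCoeff φ k‖ ^ 2 *
          ‖(fourier k (((1 / 2 ^ j : ℝ)) : Circ) : ℂ) - 1‖ ^ 2) := by
      funext k
      simp only [A, Finset.mul_sum]
      exact Finset.sum_congr rfl fun j _ => by ring
    rw [h0]
    exact hasSum_sum fun j _ => (hasSum_sqDiff φ ((1 / 2 ^ j : ℝ) : Circ)).mul_left (2 ^ j)
  have h1 : ∑ k ∈ K, ‖fourierCoeff g k‖ ^ 2 * |(k : ℝ)|
      ≤ 5 * ∑ k ∈ K, ‖fourierCoeff g k‖ ^ 2 * A k := by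
    rw [Finset.mul_sum]
    refine Finset.sum_le_sum fun k hk => ?_
    have := le_sum_dyadic k (n := n) (Nat.lt_succ_of_le (Finset.le_sup (f := Int.natAbs) hk))
    calc _ ≤ ‖fourierCoeff g k‖ ^ 2 * (5 * A k) := by gcongr
      _ = _ := by ring
  have hA : ∀ k, 0 ≤ A k := fun k => Finset.sum_nonneg fun j _ => by positivity
  have h2 := sum_le_hasSum K (fun k _ => mul_nonneg (sq_nonneg _) (hA k)) (hS g)
  have h3 : ∑ j ∈ Finset.range n, 2 ^ j * sqDiff g ((1 / 2 ^ j : ℝ) : Circ)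
      ≤ ∑ j ∈ Finset.range n, 2 ^ j * sqDiff f ((1 / 2 ^ j : ℝ) : Circ) := by
    gcongr with j _
    exact sqDiff_mono hfg _
  have h4 : ∑ j ∈ Finset.range n, 2 ^ j * sqDiff f ((1 / 2 ^ j : ℝ) : Circ)
      ≤ 12 * ∑' k : ℤ, ‖fourierCoeff f k‖ ^ 2 * |(k : ℝ)| := by
    refine hasSum_le (fun k => ?_) (hS f) (hf.hasSum.mul_left 12)
    calc _ ≤ ‖fourierCoeff f k‖ ^ 2 * (12 * |(k : ℝ)|) := by
          gcongr
          exact sum_dyadic_le k n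
      _ = _ := by ring
  linarith

theorem abs_integral_mul_diff_le {f g : C(Circ, ℝ)}
    (hf : Summable fun k : ℤ => ‖fourierCoeff (fun t => (f t : ℂ)) k‖ ^ 2 * |(k : ℝ)|)
    (hg : Summable fun k : ℤ => ‖fourierCoeff (fun t => (g t : ℂ)) k‖ ^ 2 * |(k : ℝ)|)
    (s : ℝ) :
    |∫ t, f t * (g (t + s) - g t) ∂AddCircle.haarAddCircle| ≤
      |s| * (∑' k : ℤ, ‖fourierCoeff (fun t => (f t : ℂ)) k‖ ^ 2 * |(k : ℝ)|
        + ∑' k : ℤ, ‖fourierCoeff (fun t => (g t : ℂ)) k‖ ^ 2 * |(k : ℝ)|) := by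
  set F : C(Circ, ℂ) := ⟨fun t => (f t : ℂ), by fun_prop⟩
  set G : C(Circ, ℂ) := ⟨fun t => (g t : ℂ), by fun_prop⟩
  have h := hasSum_conj_fourierCoeff_mul F (G.comp ⟨fun t => t + (s : Circ), by fun_prop⟩ - G)
  have h1 : ∫ t, (starRingEnd ℂ) (F t) * (G.comp ⟨fun t => t + (s : Circ), by fun_prop⟩ - G) t
        ∂AddCircle.haarAddCircle
      = ((∫ t, f t * (g (t + s) - g t) ∂AddCircle.haarAddCircle : ℝ) : ℂ) := by
    rw [← integral_complex_ofReal]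
    refine integral_congr_ae (Eventually.of_forall fun t => ?_)
    simp [F, G]
  rw [h1] at h
  have hb : ∀ k : ℤ, ‖(starRingEnd ℂ) (fourierCoeff F k) *
      fourierCoeff (G.comp ⟨fun t => t + (s : Circ), by fun_prop⟩ - G) k‖
      ≤ |s| * (‖fourierCoeff F k‖ ^ 2 * |(k : ℝ)| + ‖fourierCoeff G k‖ ^ 2 * |(k : ℝ)|) := by
    intro k
    have h2 := fourierCoeff_comp_add_sub G s k
    rw [show (⇑(G.comp ⟨fun t => t + (s : Circ), by fun_prop⟩ - G) : Circ → ℂ)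
      = fun t => G (t + s) - G t from rfl, h2, norm_mul, norm_mul, RCLike.norm_conj]
    have h3 := norm_fourier_coe_sub_one_le k s
    calc _ ≤ ‖fourierCoeff F k‖ * ((|(k : ℝ)| * |s|) * ‖fourierCoeff G k‖) := by gcongr
      _ = (|s| * |(k : ℝ)|) * (‖fourierCoeff F k‖ * ‖fourierCoeff G k‖) := by ring
      _ ≤ (|s| * |(k : ℝ)|) * (‖fourierCoeff F k‖ ^ 2 + ‖fourierCoeff G k‖ ^ 2) := by
        gcongr
        nlinarith [sq_nonneg (‖fourierCoeff F k‖ - ‖fourierCoeff G k‖),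
          sq_nonneg ‖fourierCoeff F k‖, sq_nonneg ‖fourierCoeff G k‖]
      _ = _ := by ring
  have h5 := tsum_of_norm_bounded ((hf.hasSum.add hg.hasSum).mul_left |s|) hb
  rw [h.tsum_eq, Complex.norm_real, Real.norm_eq_abs] at h5
  exact h5
theorem exists_lift_comp_coe (h : C(Circ, Circ)) :
    ∃ H : C(ℝ, ℝ), ∀ x : ℝ, ((H x : ℝ) : Circ) = h (x : Circ) := by
  obtain ⟨e, he⟩ := QuotientAddGroup.mk_surjective (h ((0 : ℝ) : Circ))
  obtain ⟨H, ⟨-, hH⟩, -⟩ :=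
    (AddCircle.isCoveringMap_coe (2 * Real.pi)).existsUnique_continuousMap_lifts
      (h.comp ⟨fun x : ℝ => (x : Circ), AddCircle.continuous_mk' _⟩) 0 e he
  exact ⟨H, fun x => congrFun hH x⟩

theorem sub_eq_const_of_coe_eq {f : ℝ → ℝ} (hf : Continuous f)
    (h : ∀ x, ((f x : ℝ) : Circ) = (x : Circ)) : ∃ c : ℝ, ∀ x, f x = x + c := by
  refine ⟨f 0, fun x => ?_⟩
  have := (AddCircle.isCoveringMap_coe (2 * Real.pi)).const_of_comp
    (g := fun x => f x - x) (by fun_prop) (fun a b => by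
      simp only [AddCircle.coe_sub, h, sub_self]) x 0
  simp only [sub_zero] at this
  linarith

/-- A lift of a circle homeomorphism to the line is strictly monotone, up to reversing the line,
and commutes with the period. -/
theorem exists_strictMono_lift (h : Circ ≃ₜ Circ) :
    ∃ (σ : ℝ) (H : ℝ → ℝ), (σ = 1 ∨ σ = -1) ∧ StrictMono H ∧ Function.Surjective H ∧
      (∀ x, H (x + 2 * Real.pi) = H x + 2 * Real.pi) ∧
      ∀ x : ℝ, ((H x : ℝ) : Circ) = h ((σ * x : ℝ) : Circ) := by
  obtain ⟨H, hH⟩ := exists_lift_comp_coe ⟨h, h.continuous⟩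
  obtain ⟨G, hG⟩ := exists_lift_comp_coe ⟨h.symm, h.symm.continuous⟩
  simp only [ContinuousMap.coe_mk] at hH hG
  obtain ⟨c, hc⟩ := sub_eq_const_of_coe_eq (G.continuous.comp H.continuous)
    (fun x => by simp [hG, hH])
  obtain ⟨d, hd⟩ := sub_eq_const_of_coe_eq (H.continuous.comp G.continuous)
    (fun x => by simp [hG, hH])
  simp only [Function.comp_apply] at hc hd
  have hinj : Function.Injective H := fun x y hxy => by
    have h1 := hc x
    rw [hxy, hc y] at h1
    linarith
  have hsurj : Function.Surjective H := fun y => ⟨G (y - d), by rw [hd]; ring⟩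
  have hper : ∀ (F : C(ℝ, ℝ)) (k : Circ → Circ), (∀ x : ℝ, ((F x : ℝ) : Circ) = k (x : Circ)) →
      ∃ n : ℤ, ∀ x, F (x + 2 * Real.pi) = F x + n * (2 * Real.pi) := by
    intro F k hF
    have h1 := (AddCircle.isCoveringMap_coe (2 * Real.pi)).const_of_comp
      (g := fun x => F (x + 2 * Real.pi) - F x) (by fun_prop) (fun a b => by
        simp only [AddCircle.coe_sub, hF, AddCircle.coe_add, AddCircle.coe_period]
        simp)
    have h2 : ((F (0 + 2 * Real.pi) - F 0 : ℝ) : Circ) = 0 := by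
      simp only [AddCircle.coe_sub, hF, AddCircle.coe_add, AddCircle.coe_period]
      simp
    obtain ⟨n, hn⟩ := (AddCircle.coe_eq_zero_iff _).1 h2
    refine ⟨n, fun x => ?_⟩
    have h3 := h1 x 0
    simp only [zsmul_eq_mul] at hn h3
    linarith
  obtain ⟨n, hn⟩ := hper H h hH
  obtain ⟨m, hm⟩ := hper G h.symm hG
  have hpi := Real.pi_pos
  have hGn : ∀ (j : ℤ) (x : ℝ), G (x + j * (2 * Real.pi)) = G x + j * (m * (2 * Real.pi)) := by
    intro j x
    induction j using Int.induction_on with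
    | zero => simp
    | succ i ih =>
      have := hm (x + i * (2 * Real.pi))
      push_cast at ih ⊢
      rw [show x + (i + 1) * (2 * Real.pi) = x + i * (2 * Real.pi) + 2 * Real.pi by ring, this, ih]
      ring
    | pred i ih =>
      have := hm (x + (-i - 1) * (2 * Real.pi))
      push_cast at ih ⊢
      rw [show x + (-i - 1) * (2 * Real.pi) + 2 * Real.pi = x + -i * (2 * Real.pi) by ring,
        ih] at this
      linarith
  have hnm : n * m = 1 := by
    have h1 := hc (0 + 2 * Real.pi)
    rw [hn, hGn, hc] at h1
    have h2 : ((n * m : ℤ) : ℝ) * (2 * Real.pi) = 1 * (2 * Real.pi) := by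
      push_cast
      linarith
    exact_mod_cast mul_right_cancel₀ (by positivity) h2
  rcases H.continuous.strictMono_of_inj hinj with hmono | hanti
  · refine ⟨1, H, Or.inl rfl, hmono, hsurj, ?_, by simp [hH]⟩
    have h1 : (n : ℝ) = 1 := by
      rcases Int.eq_one_or_neg_one_of_mul_eq_one hnm with h | h
      · simp [h]
      · have := hmono (show (0 : ℝ) < 0 + 2 * Real.pi by linarith)
        rw [hn, h] at this
        push_cast at this
        linarith
    intro x
    rw [hn, h1, one_mul]
  · refine ⟨-1, fun x => H (-x), Or.inr rfl, fun a b hab => hanti (neg_lt_neg hab),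
      hsurj.comp neg_surjective, ?_, by simp [hH]⟩
    have h1 : (n : ℝ) = -1 := by
      rcases Int.eq_one_or_neg_one_of_mul_eq_one hnm with h | h
      · have := hanti (show (0 : ℝ) < 0 + 2 * Real.pi by linarith)
        rw [hn, h] at this
        push_cast at this
        linarith
      · simp [h]
    intro x
    have := hn (-(x + 2 * Real.pi))
    rw [h1] at this
    rw [show -(x + 2 * Real.pi) + 2 * Real.pi = -x by ring] at this
    linarith

theorem summable_sq_fourierCoeff_comp_neg (f : Circ → ℂ)
    (hf : Summable fun k : ℤ => ‖fourierCoeff f k‖ ^ 2 * |(k : ℝ)|) :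
    Summable fun k : ℤ => ‖fourierCoeff (fun t => f (-t)) k‖ ^ 2 * |(k : ℝ)| := by
  have h : ∀ k : ℤ, fourierCoeff (fun t => f (-t)) k = fourierCoeff f (-k) := by
    intro k
    unfold fourierCoeff
    rw [← integral_neg_eq_self]
    refine integral_congr_ae (Eventually.of_forall fun t => ?_)
    simp [fourier_apply]
  have h2 := (Equiv.neg ℤ).summable_iff.2 hf
  refine h2.congr fun k => ?_
  simp [h]

/-- Lower bound for difference quotients of the area `∫ f dg`, where `g` is a bump of height `τ`
that rises while `f = c` and falls while `f = 0`. -/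
theorem eventually_le_integral_mul_diff {f g : ℝ → ℝ} {P p q s w c τ : ℝ}
    (hf : Continuous f) (hg : Continuous g) (hgP : ∀ t, g (t + P) = g t)
    (hpq : p < q) (hqs : q < s) (hsw : s < w) (hwP : w < p + P)
    (hg0 : ∀ t, 0 ≤ g t) (hgz : ∀ t ∈ Set.Icc w (p + P), g t = 0)
    (hgτ : ∀ t ∈ Set.Icc q s, g t = τ)
    (hmono : MonotoneOn g (Set.Icc p q)) (hanti : AntitoneOn g (Set.Icc s w))
    (hfc : ∀ t ∈ Set.Icc p q, f t = c) (hf0 : ∀ t ∈ Set.Icc s w, f t = 0)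
    {η : ℝ} (hη : 0 < η) :
    ∀ᶠ ε in nhdsWithin (0 : ℝ) (Set.Ioi 0),
      (c - 2 * η) * τ * ε ≤ ∫ t in (p - ε)..(p - ε + P), f t * (g (t + ε) - g t) := by
  obtain ⟨d₁, hd₁, hp⟩ := Metric.continuousAt_iff.1 (hf.continuousAt (x := p)) η hη
  obtain ⟨d₂, hd₂, hs⟩ := Metric.continuousAt_iff.1 (hf.continuousAt (x := s)) η hη
  have hm : 0 < min (min d₁ d₂) (min (s - q) (p + P - w)) := by
    simp only [lt_min_iff]
    exact ⟨⟨hd₁, hd₂⟩, by linarith, by linarith⟩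
  filter_upwards [Ioo_mem_nhdsGT hm] with ε hε
  obtain ⟨hε0, hε⟩ := hε
  simp only [lt_min_iff] at hε
  obtain ⟨⟨hε1, hε2⟩, hε3, hε4⟩ := hε
  have hgz' : ∀ t ∈ Set.Icc (p - ε) p, g t = 0 := fun t ht => by
    rw [← hgP]
    exact hgz _ ⟨by linarith [ht.1], by linarith [ht.2]⟩
  have hii : ∀ (φ : ℝ → ℝ) (a b : ℝ), Continuous φ → IntervalIntegrable φ volume a b :=
    fun φ a b hφ => hφ.intervalIntegrable a b
  have hle : ∀ t, g t ≤ g (t + ε) → p - ε ≤ t → t ≤ q → (c - 2 * η) * (g (t + ε) - g t)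
      ≤ (f t - η) * (g (t + ε) - g t) := by
    intro t ht htp htq
    refine mul_le_mul_of_nonneg_right ?_ (by linarith)
    rcases le_total p t with h | h
    · rw [hfc t ⟨h, htq⟩]; linarith
    · have h1 := hp (x := t) (by rw [Real.dist_eq, abs_lt]; constructor <;> linarith)
      rw [hfc p ⟨le_rfl, hpq.le⟩, Real.dist_eq, abs_lt] at h1
      linarith [h1.1]
  have hrise : ∀ t ∈ Set.Icc (p - ε) q, g t ≤ g (t + ε) := by
    intro t ht
    rcases le_total t p with h | h
    · rw [hgz' t ⟨ht.1, h⟩]; exact hg0 _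
    · rcases le_total (t + ε) q with h' | h'
      · exact hmono ⟨h, ht.2⟩ ⟨by linarith, h'⟩ (by linarith)
      · rw [hgτ (t + ε) ⟨h', by linarith [ht.2]⟩, ← hgτ q ⟨le_rfl, hqs.le⟩]
        exact hmono ⟨h, ht.2⟩ ⟨hpq.le, le_rfl⟩ ht.2
  have hrest : ∀ t ∈ Set.Icc q (p - ε + P), 0 ≤ (f t - η) * (g (t + ε) - g t) := by
    intro t ht
    have hd : ∀ x ∈ Set.Icc s w, ∀ y ∈ Set.Icc s (p + P), x ≤ y → g y ≤ g x := by
      intro x hx y hy hxy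
      rcases le_total y w with h | h
      · exact hanti hx ⟨hy.1, h⟩ hxy
      · rw [hgz y ⟨h, hy.2⟩]; exact hg0 _
    rcases le_total t (s - ε) with h | h
    · rw [hgτ t ⟨ht.1, by linarith⟩, hgτ (t + ε) ⟨by linarith [ht.1], by linarith⟩]
      simp
    rcases le_total w t with h' | h'
    · rw [hgz t ⟨h', by linarith [ht.2]⟩, hgz (t + ε) ⟨by linarith, by linarith [ht.2]⟩]
      simp
    refine mul_nonneg_of_nonpos_of_nonpos ?_ ?_
    · rcases le_total s t with h'' | h''
      · rw [hf0 t ⟨h'', h'⟩]; linarith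
      · have h1 := hs (x := t) (by rw [Real.dist_eq, abs_lt]; constructor <;> linarith)
        rw [hf0 s ⟨le_rfl, hsw.le⟩, Real.dist_eq, abs_lt] at h1
        linarith [h1.2]
    · rcases le_total s t with h'' | h''
      · linarith [hd t ⟨h'', h'⟩ (t + ε) ⟨by linarith, by linarith [ht.2]⟩ (by linarith)]
      · rw [hgτ t ⟨ht.1, h''⟩, ← hgτ s ⟨hqs.le, le_rfl⟩]
        linarith [hd s ⟨le_rfl, hsw.le⟩ (t + ε) ⟨by linarith, by linarith [ht.2]⟩ (by linarith)]
  have hzero : ∫ t in (p - ε)..(p - ε + P), (g (t + ε) - g t) = 0 := by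
    rw [intervalIntegral.integral_sub (hii _ _ _ (by fun_prop)) (hii _ _ _ hg),
      intervalIntegral.integral_comp_add_right (fun t => g t),
      show p - ε + P + ε = p - ε + ε + P by ring,
      (show Function.Periodic g P from hgP).intervalIntegral_add_eq (p - ε + ε) (p - ε), sub_self]
  have hup : ∫ t in (p - ε)..q, (g (t + ε) - g t) = τ * ε := by
    rw [intervalIntegral.integral_sub (hii _ _ _ (by fun_prop)) (hii _ _ _ hg),
      intervalIntegral.integral_comp_add_right (fun t => g t),
      ← intervalIntegral.integral_add_adjacent_intervals (b := q) (hii g _ _ hg) (hii g _ _ hg),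
      ← intervalIntegral.integral_add_adjacent_intervals (a := p - ε) (b := p) (hii g _ _ hg)
        (hii g _ _ hg), sub_add_cancel]
    have h1 : ∫ t in q..(q + ε), g t = ∫ t in q..(q + ε), τ :=
      intervalIntegral.integral_congr fun t ht => by
        rw [Set.uIcc_of_le (by linarith)] at ht
        exact hgτ t ⟨ht.1, by linarith [ht.2]⟩
    have h2 : ∫ t in (p - ε)..p, g t = ∫ t in (p - ε)..p, 0 :=
      intervalIntegral.integral_congr fun t ht => by
        rw [Set.uIcc_of_le (by linarith)] at ht
        exact hgz' t ht
    rw [h1, h2]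
    simp
    ring
  have hsplit : ∫ t in (p - ε)..(p - ε + P), f t * (g (t + ε) - g t)
      = (∫ t in (p - ε)..q, (f t - η) * (g (t + ε) - g t))
        + ∫ t in q..(p - ε + P), (f t - η) * (g (t + ε) - g t) := by
    rw [intervalIntegral.integral_add_adjacent_intervals (hii _ _ _ (by fun_prop))
      (hii _ _ _ (by fun_prop))]
    have : ∀ t, (f t - η) * (g (t + ε) - g t)
        = f t * (g (t + ε) - g t) - η * (g (t + ε) - g t) := fun t => by ring
    simp_rw [this]
    rw [intervalIntegral.integral_sub (hii _ _ _ (by fun_prop)) (hii _ _ _ (by fun_prop)),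
      intervalIntegral.integral_const_mul, hzero, mul_zero, sub_zero]
  rw [hsplit]
  have h1 : (c - 2 * η) * τ * ε ≤ ∫ t in (p - ε)..q, (f t - η) * (g (t + ε) - g t) := by
    rw [mul_assoc, ← hup, ← intervalIntegral.integral_const_mul]
    exact intervalIntegral.integral_mono_on (by linarith) (hii _ _ _ (by fun_prop))
      (hii _ _ _ (by fun_prop)) fun t ht => hle t (hrise t ht) ht.1 ht.2
  have h2 : 0 ≤ ∫ t in q..(p - ε + P), (f t - η) * (g (t + ε) - g t) :=
    intervalIntegral.integral_nonneg (by linarith) hrest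
  linarith
theorem norm_coe_eq_abs {x : ℝ} (hx : |x| ≤ Real.pi) : ‖(x : Circ)‖ = |x| := by
  have hpi := Real.pi_pos
  rw [AddCircle.norm_coe_eq_abs_iff (2 * Real.pi) (by positivity),
    abs_of_pos (show 0 < 2 * Real.pi by positivity)]
  linarith

theorem le_norm_coe_of_le_abs {a x : ℝ} (h1 : a ≤ |x|) (h2 : |x| ≤ 2 * Real.pi - a) :
    a ≤ ‖(x : Circ)‖ := by
  have hpi := Real.pi_pos
  rcases le_or_gt |x| Real.pi with h | h
  · rwa [norm_coe_eq_abs h]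
  rcases le_total 0 x with hx | hx
  · rw [abs_of_nonneg hx] at h h1 h2
    have h3 : ((x - 2 * Real.pi : ℝ) : Circ) = (x : Circ) := by
      rw [AddCircle.coe_sub, AddCircle.coe_period, sub_zero]
    rw [← h3]
    have h4 : |x - 2 * Real.pi| = 2 * Real.pi - x ∨ a ≤ 0 := by
      rcases le_total x (2 * Real.pi) with h' | h'
      · left
        rw [abs_of_nonpos (by linarith)]
        ring
      · right
        linarith
    rcases h4 with h4 | h4
    · rw [norm_coe_eq_abs (by linarith), h4]
      linarith
    · exact h4.trans (norm_nonneg _)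
  · rw [abs_of_nonpos hx] at h h1 h2
    have h3 : ((x + 2 * Real.pi : ℝ) : Circ) = (x : Circ) := by
      rw [AddCircle.coe_add, AddCircle.coe_period, add_zero]
    rw [← h3]
    have h4 : |x + 2 * Real.pi| = 2 * Real.pi + x ∨ a ≤ 0 := by
      rcases le_total (-x) (2 * Real.pi) with h' | h'
      · left
        rw [abs_of_nonneg (by linarith)]
        ring
      · right
        linarith
    rcases h4 with h4 | h4
    · rw [norm_coe_eq_abs (by linarith), h4]
      linarith
    · exact h4.trans (norm_nonneg _)

/-- The trapezoidal bump of height `r` on the circle, equal to `r` on the arc of length `d`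
centred at `c` and vanishing off the concentric arc of length `3 * d`. -/
def bump (c d r : ℝ) (t : Circ) : ℝ :=
  r * max 0 (min 1 (3 / 2 - dist t (c : Circ) / d))

theorem continuous_bump (c d r : ℝ) : Continuous (bump c d r) := by
  unfold bump
  fun_prop

theorem bump_nonneg {c d r : ℝ} (hr : 0 ≤ r) (t : Circ) : 0 ≤ bump c d r t :=
  mul_nonneg hr (le_max_left _ _)

theorem bump_le {c d r : ℝ} (hr : 0 ≤ r) (t : Circ) : bump c d r t ≤ r :=
  mul_le_of_le_one_right hr (max_le zero_le_one (min_le_left _ _))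

theorem bump_eq_zero {c d r : ℝ} (hd : 0 < d) {t : Circ} (h : 3 / 2 * d ≤ dist t (c : Circ)) :
    bump c d r t = 0 := by
  rw [← le_div_iff₀ hd] at h
  rw [bump, max_eq_left, mul_zero]
  exact (min_le_right _ _).trans (by linarith)

theorem bump_coe_eq_zero {c d r y : ℝ} (hd : 0 < d) (h1 : 3 / 2 * d ≤ |y - c|)
    (h2 : |y - c| ≤ 2 * Real.pi - 3 / 2 * d) : bump c d r (y : Circ) = 0 := by
  refine bump_eq_zero hd ?_
  rw [dist_eq_norm, ← AddCircle.coe_sub]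
  exact le_norm_coe_of_le_abs h1 h2

theorem bump_coe_eq {c d r y : ℝ} (hd : 0 < d) (hdpi : d ≤ Real.pi) (h : |y - c| ≤ d / 2) :
    bump c d r (y : Circ) = r := by
  have h1 : |y - c| / d ≤ 1 / 2 := by
    rw [div_le_iff₀ hd]
    linarith
  rw [bump, dist_eq_norm, ← AddCircle.coe_sub, norm_coe_eq_abs (by linarith),
    min_eq_left (by linarith), max_eq_right zero_le_one, mul_one]

theorem bump_coe_le_bump_coe {c d r x y : ℝ} (hd : 0 < d) (hr : 0 ≤ r) (hxy : |y - c| ≤ |x - c|)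
    (hx : |x - c| ≤ Real.pi) : bump c d r (x : Circ) ≤ bump c d r (y : Circ) := by
  unfold bump
  rw [dist_eq_norm, dist_eq_norm, ← AddCircle.coe_sub, ← AddCircle.coe_sub, norm_coe_eq_abs hx,
    norm_coe_eq_abs (hxy.trans hx)]
  gcongr

theorem abs_bump_sub_le {c d r : ℝ} (hd : 0 < d) (hr : 0 ≤ r) (s t : Circ) :
    |bump c d r s - bump c d r t| ≤ r * min 1 (dist s t / d) := by
  rw [mul_min_of_nonneg _ _ hr, mul_one]
  refine le_min ?_ ?_
  · rw [abs_le]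
    constructor <;>
      linarith [bump_nonneg (c := c) (d := d) hr s, bump_nonneg (c := c) (d := d) hr t,
        bump_le (c := c) (d := d) hr s, bump_le (c := c) (d := d) hr t]
  · have h1 : |dist s (c : Circ) - dist t (c : Circ)| ≤ dist s t := abs_dist_sub_le _ _ _
    unfold bump
    rw [← mul_sub, abs_mul, abs_of_nonneg hr]
    refine mul_le_mul_of_nonneg_left ?_ hr
    calc _ ≤ |(min 1 (3 / 2 - dist s (c : Circ) / d)) - (min 1 (3 / 2 - dist t (c : Circ) / d))| :=
          (abs_max_sub_max_le_max 0 _ 0 _).trans (by simp)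
      _ ≤ |(3 / 2 - dist s (c : Circ) / d) - (3 / 2 - dist t (c : Circ) / d)| :=
          (abs_min_sub_min_le_max 1 _ 1 _).trans (by simp)
      _ = |dist s (c : Circ) - dist t (c : Circ)| / d := by
          rw [← abs_of_pos hd, ← abs_div, abs_of_pos hd, ← abs_neg]
          congr 1
          ring
      _ ≤ dist s t / d := by gcongr

theorem IsModulusOfContinuity.natCast_mul_le {ω : ℝ → ℝ} (hω : IsModulusOfContinuity ω) (n : ℕ)
    {t : ℝ} (ht : 0 ≤ t) : ω (n * t) ≤ n * ω t := by
  obtain ⟨-, -, h0, -, hadd⟩ := hω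
  induction n with
  | zero => simp [h0]
  | succ n ih =>
    have := hadd (n * t) t (by positivity) ht
    push_cast
    rw [add_mul, one_mul, add_mul, one_mul]
    linarith

theorem IsModulusOfContinuity.mul_min_le {ω : ℝ → ℝ} (hω : IsModulusOfContinuity ω)
    {d t : ℝ} (hd : 0 < d) (ht : 0 ≤ t) : ω d * min 1 (t / d) ≤ 2 * ω t := by
  have hpos := hω.2.2.2.1
  have hmono := hω.2.1
  rcases ht.eq_or_lt with rfl | ht'
  · simp [hω.2.2.1]
  rcases le_total d t with h | h
  · have h1 : ω d ≤ ω t := hmono hd.le ht h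
    have h2 : ω d * min 1 (t / d) ≤ ω d * 1 :=
      mul_le_mul_of_nonneg_left (min_le_left _ _) (hpos d hd.le)
    linarith [hpos t ht]
  · have h1 : d ≤ ⌈d / t⌉₊ * t := by
      rw [← div_le_iff₀ ht']
      exact Nat.le_ceil _
    have h2 : ω d ≤ ⌈d / t⌉₊ * ω t :=
      (hmono hd.le (hd.le.trans h1) h1).trans (hω.natCast_mul_le _ ht)
    have h3 : (⌈d / t⌉₊ : ℝ) ≤ 2 * (d / t) := by
      have := (Nat.ceil_lt_add_one (show 0 ≤ d / t by positivity)).le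
      have h4 : 1 ≤ d / t := by rwa [one_le_div ht']
      linarith
    have h4 : ω d ≤ 2 * (d / t) * ω t := h2.trans (by have := hpos t ht; gcongr)
    calc ω d * min 1 (t / d) ≤ ω d * (t / d) :=
          mul_le_mul_of_nonneg_left (min_le_right _ _) (hpos d hd.le)
      _ ≤ 2 * (d / t) * ω t * (t / d) := by gcongr
      _ = 2 * ω t := by field_simp

theorem IsModulusOfContinuity.continuous_of_abs_sub_le {ω : ℝ → ℝ} (hω : IsModulusOfContinuity ω)
    {u : Circ → ℝ} {C : ℝ} (hu : ∀ s t, |u s - u t| ≤ C * ω (dist s t)) : Continuous u := by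
  rw [continuous_iff_continuousAt]
  intro t
  rw [ContinuousAt, tendsto_iff_dist_tendsto_zero]
  refine squeeze_zero (fun _ => dist_nonneg) (fun s => ?_) (g := fun s => C * ω (dist s t)) ?_
  · rw [Real.dist_eq]
    exact hu s t
  · have h1 : Tendsto (fun s => dist s t) (nhds t) (nhdsWithin 0 (Set.Ici 0)) :=
      tendsto_nhdsWithin_iff.2 ⟨tendsto_iff_dist_tendsto_zero.1 tendsto_id,
        Eventually.of_forall fun s => dist_nonneg⟩
    have h2 : Tendsto ω (nhdsWithin 0 (Set.Ici 0)) (nhds 0) := by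
      have := hω.1 0 (Set.mem_Ici.2 le_rfl)
      rwa [ContinuousWithinAt, hω.2.2.1] at this
    simpa using (h2.comp h1).const_mul C

section DisjointSum

variable {ι X : Type*} {w : ι → X → ℝ}

theorem tsum_apply_of_disjoint (hw : ∀ x, Pairwise fun i j => w i x = 0 ∨ w j x = 0) {x : X}
    {i : ι} (hi : w i x ≠ 0) : ∑' j, w j x = w i x :=
  tsum_eq_single i fun _ hj => (hw x hj).resolve_right hi

theorem abs_tsum_sub_tsum_le (hw : ∀ x, Pairwise fun i j => w i x = 0 ∨ w j x = 0) {x y : X}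
    {C : ℝ} (hC : 0 ≤ C) (h : ∀ i, |w i x - w i y| ≤ C) :
    |∑' i, w i x - ∑' i, w i y| ≤ 2 * C := by
  have hz : ∀ z, (∀ i, w i z = 0) → ∑' i, w i z = 0 := fun z hz => by simp [hz]
  by_cases hx : ∃ i, w i x ≠ 0
  · obtain ⟨i, hi⟩ := hx
    rw [tsum_apply_of_disjoint hw hi]
    by_cases hy : ∃ j, w j y ≠ 0
    · obtain ⟨j, hj⟩ := hy
      rw [tsum_apply_of_disjoint hw hj]
      rcases eq_or_ne i j with rfl | hij
      · linarith [h i]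
      · have h1 := h i
        have h2 := h j
        rw [(hw y hij).resolve_right hj] at h1
        rw [(hw x hij).resolve_left hi] at h2
        rw [abs_le] at *
        constructor <;> linarith
    · push Not at hy
      have h1 := h i
      rw [hz y hy]
      rw [hy i] at h1
      linarith
  · push Not at hx
    rw [hz x hx]
    by_cases hy : ∃ j, w j y ≠ 0
    · obtain ⟨j, hj⟩ := hy
      rw [tsum_apply_of_disjoint hw hj]
      have h1 := h j
      rw [hx j] at h1
      linarith
    · push Not at hy
      rw [hz y hy]
      simpa using hC

theorem apply_tsum_eq_sum (hw : ∀ x, Pairwise fun i j => w i x = 0 ∨ w j x = 0) {T : ℝ → ℝ}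
    (hT : T 0 = 0) {S : Finset ι} (hS : ∀ i ∉ S, ∀ x, T (w i x) = 0) (x : X) :
    T (∑' i, w i x) = ∑ i ∈ S, T (w i x) := by
  by_cases hx : ∃ i, w i x ≠ 0
  · obtain ⟨i, hi⟩ := hx
    rw [tsum_apply_of_disjoint hw hi]
    refine (Finset.sum_eq_single (f := fun j => T (w j x)) i (fun j _ hj => ?_)
      (fun h => hS i h x)).symm
    rw [(hw x hj).resolve_right hi, hT]
  · push Not at hx
    simp [hx, hT]

end DisjointSum

theorem exists_coe_eq (t : Circ) : ∃ y : ℝ, 0 ≤ y ∧ y ≤ 2 * Real.pi ∧ (y : Circ) = t := by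
  obtain ⟨y, hy, h⟩ := AddCircle.coe_image_Icc_eq (2 * Real.pi) 0 ▸ Set.mem_univ t
  exact ⟨y, hy.1, by simpa using hy.2, h⟩

/-- A family of nonoverlapping arcs `[start j, start j + 4 * width j]` of the circle, each of them
assigned to one loop of the plane curve around a square of side `height j`. -/
structure LoopFamily (ι : Type*) where
  start : ι → ℝ
  width : ι → ℝ
  height : ι → ℝ
  width_pos : ∀ j, 0 < width j
  height_pos : ∀ j, 0 < height j
  start_nonneg : ∀ j, 0 ≤ start j
  finish_le : ∀ j, start j + 4 * width j ≤ 2 * Real.pi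
  nonoverlap : Pairwise fun i j =>
    start i + 4 * width i ≤ start j ∨ start j + 4 * width j ≤ start i

namespace LoopFamily

variable {ι : Type*} (L : LoopFamily ι)

/-- The part of the first coordinate on a single arc. -/
def fstPiece (j : ι) : Circ → ℝ := bump (L.start j + 3 / 2 * L.width j) (L.width j) (L.height j)

/-- The part of the second coordinate on a single arc. -/
def sndPiece (j : ι) : Circ → ℝ := bump (L.start j + 5 / 2 * L.width j) (L.width j) (L.height j)

/-- The first coordinate of the curve. -/
def fst (t : Circ) : ℝ := ∑' j, L.fstPiece j t

/-- The second coordinate of the curve. -/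
def snd (t : Circ) : ℝ := ∑' j, L.sndPiece j t

theorem mem_of_fstPiece_ne_zero {j : ι} {y : ℝ} (hy0 : 0 ≤ y) (hy : y ≤ 2 * Real.pi)
    (h : L.fstPiece j (y : Circ) ≠ 0) :
    L.start j < y ∧ y < L.start j + 3 * L.width j := by
  have h0 := L.width_pos j
  have h1 := L.start_nonneg j
  have h2 := L.finish_le j
  by_contra hcon
  refine h (bump_coe_eq_zero h0 ?_ ?_)
  · rw [le_abs]
    by_contra hc
    push Not at hc
    exact hcon ⟨by linarith [hc.2], by linarith [hc.1]⟩
  · rw [abs_le]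
    constructor <;> linarith

theorem mem_of_sndPiece_ne_zero {j : ι} {y : ℝ} (hy0 : 0 ≤ y) (hy : y ≤ 2 * Real.pi)
    (h : L.sndPiece j (y : Circ) ≠ 0) :
    L.start j + L.width j < y ∧ y < L.start j + 4 * L.width j := by
  have h0 := L.width_pos j
  have h1 := L.start_nonneg j
  have h2 := L.finish_le j
  by_contra hcon
  refine h (bump_coe_eq_zero h0 ?_ ?_)
  · rw [le_abs]
    by_contra hc
    push Not at hc
    exact hcon ⟨by linarith [hc.2], by linarith [hc.1]⟩
  · rw [abs_le]
    constructor <;> linarith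

theorem fstPiece_disjoint (t : Circ) :
    Pairwise fun i j => L.fstPiece i t = 0 ∨ L.fstPiece j t = 0 := by
  intro i j hij
  obtain ⟨y, hy0, hy, rfl⟩ := exists_coe_eq t
  by_contra! hcon
  have h1 := L.mem_of_fstPiece_ne_zero hy0 hy hcon.1
  have h2 := L.mem_of_fstPiece_ne_zero hy0 hy hcon.2
  have h3 := L.width_pos i
  have h4 := L.width_pos j
  rcases L.nonoverlap hij with h | h <;> linarith [h1.1, h1.2, h2.1, h2.2]

theorem sndPiece_disjoint (t : Circ) :
    Pairwise fun i j => L.sndPiece i t = 0 ∨ L.sndPiece j t = 0 := by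
  intro i j hij
  obtain ⟨y, hy0, hy, rfl⟩ := exists_coe_eq t
  by_contra! hcon
  have h1 := L.mem_of_sndPiece_ne_zero hy0 hy hcon.1
  have h2 := L.mem_of_sndPiece_ne_zero hy0 hy hcon.2
  have h3 := L.width_pos i
  have h4 := L.width_pos j
  rcases L.nonoverlap hij with h | h <;> linarith [h1.1, h1.2, h2.1, h2.2]

theorem abs_fst_sub_le {ω : ℝ → ℝ} (hω : IsModulusOfContinuity ω)
    (hL : ∀ j, L.height j = ω (L.width j)) (s t : Circ) :
    |L.fst s - L.fst t| ≤ 4 * ω (dist s t) := by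
  have h := abs_tsum_sub_tsum_le (x := s) (y := t) L.fstPiece_disjoint
    (mul_nonneg zero_le_two (hω.2.2.2.1 _ (dist_nonneg (x := s) (y := t)))) fun j =>
      (abs_bump_sub_le (L.width_pos j) (L.height_pos j).le s t).trans
        (by rw [hL j]; exact hω.mul_min_le (L.width_pos j) dist_nonneg)
  calc _ ≤ _ := h
    _ = _ := by ring

theorem abs_snd_sub_le {ω : ℝ → ℝ} (hω : IsModulusOfContinuity ω)
    (hL : ∀ j, L.height j = ω (L.width j)) (s t : Circ) :
    |L.snd s - L.snd t| ≤ 4 * ω (dist s t) := by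
  have h := abs_tsum_sub_tsum_le (x := s) (y := t) L.sndPiece_disjoint
    (mul_nonneg zero_le_two (hω.2.2.2.1 _ (dist_nonneg (x := s) (y := t)))) fun j =>
      (abs_bump_sub_le (L.width_pos j) (L.height_pos j).le s t).trans
        (by rw [hL j]; exact hω.mul_min_le (L.width_pos j) dist_nonneg)
  calc _ ≤ _ := h
    _ = _ := by ring

theorem fst_coe_eq_height {j : ι} {y : ℝ}
    (hy : y ∈ Set.Icc (L.start j + L.width j) (L.start j + 2 * L.width j)) :
    L.fst (y : Circ) = L.height j := by
  have h0 := L.width_pos j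
  have h1 := L.start_nonneg j
  have h2 := L.finish_le j
  have h3 : L.fstPiece j (y : Circ) = L.height j :=
    bump_coe_eq h0 (by linarith) (by rw [abs_le]; constructor <;> linarith [hy.1, hy.2])
  rw [fst, tsum_apply_of_disjoint L.fstPiece_disjoint (i := j) (h3 ▸ (L.height_pos j).ne'), h3]

theorem fst_coe_eq_zero {j : ι} {y : ℝ}
    (hy : y ∈ Set.Icc (L.start j + 3 * L.width j) (L.start j + 4 * L.width j)) :
    L.fst (y : Circ) = 0 := by
  have h0 := L.width_pos j
  have h1 := L.start_nonneg j
  have h2 := L.finish_le j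
  have h3 : ∀ i, L.fstPiece i (y : Circ) = 0 := by
    intro i
    by_contra hne
    have h4 := L.mem_of_fstPiece_ne_zero (by linarith [hy.1]) (by linarith [hy.2]) hne
    have h5 := L.width_pos i
    rcases eq_or_ne i j with rfl | hij
    · linarith [h4.2, hy.1]
    · rcases L.nonoverlap hij with h | h <;> linarith [h4.1, h4.2, hy.1, hy.2]
  simp [fst, h3]

/-- The contribution of one loop to the area enclosed by the reparametrized curve, after
subtracting the threshold `ρ` from the second coordinate. -/
theorem eventually_le_integral_piece {H : ℝ → ℝ} (hHm : StrictMono H) (hHs : Function.Surjective H)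
    (hHp : ∀ x, H (x + 2 * Real.pi) = H x + 2 * Real.pi)
    {k : C(Circ, Circ)} (hHk : ∀ x : ℝ, ((H x : ℝ) : Circ) = k (x : Circ))
    (hc : Continuous L.fst) {ρ : ℝ} (hρ : 0 < ρ) (j : ι) :
    ∀ᶠ ε : ℝ in nhdsWithin (0 : ℝ) (Set.Ioi 0),
      max (L.height j - ρ) 0 ^ 2 * ε ≤ 2 * Real.pi * ∫ t, L.fst (k t) *
        (max (L.sndPiece j (k (t + (ε : Circ))) - ρ) 0 - max (L.sndPiece j (k t) - ρ) 0)
          ∂AddCircle.haarAddCircle := by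
  have h0 := L.width_pos j
  have h1 := L.start_nonneg j
  have h2 := L.finish_le j
  have hpi := Real.pi_pos
  have hh := L.height_pos j
  obtain ⟨p, hp⟩ := hHs (L.start j + L.width j)
  obtain ⟨q, hq⟩ := hHs (L.start j + 2 * L.width j)
  obtain ⟨s, hs⟩ := hHs (L.start j + 3 * L.width j)
  obtain ⟨w, hw⟩ := hHs (L.start j + 4 * L.width j)
  have hbc : Continuous (L.sndPiece j) := continuous_bump _ _ _
  have hcoe : Continuous fun x : ℝ => (x : Circ) := AddCircle.continuous_mk' _
  have hmem : ∀ {a b t : ℝ}, t ∈ Set.Icc a b → H t ∈ Set.Icc (H a) (H b) :=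
    fun ht => ⟨hHm.monotone ht.1, hHm.monotone ht.2⟩
  have key := eventually_le_integral_mul_diff (f := fun t => L.fst (k (t : Circ)))
    (g := fun t => max (L.sndPiece j (k (t : Circ)) - ρ) 0) (P := 2 * Real.pi)
    (p := p) (q := q) (s := s) (w := w) (c := L.height j) (τ := max (L.height j - ρ) 0)
    (by fun_prop) (by fun_prop)
    (fun t => by rw [AddCircle.coe_add, AddCircle.coe_period, add_zero])
    (hHm.lt_iff_lt.1 (by linarith)) (hHm.lt_iff_lt.1 (by linarith))
    (hHm.lt_iff_lt.1 (by linarith)) (hHm.lt_iff_lt.1 (by rw [hHp]; linarith))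
    (fun t => le_max_right _ _)
    (fun t ht => by
      have hy := hmem ht
      rw [hHp, hw, hp] at hy
      have : L.sndPiece j ((H t : ℝ) : Circ) = 0 := by
        refine bump_coe_eq_zero h0 ?_ ?_
        · rw [le_abs]; left; linarith [hy.1]
        · rw [abs_le]; constructor <;> linarith [hy.1, hy.2]
      rw [← hHk, this]
      exact max_eq_right (by linarith))
    (fun t ht => by
      have hy := hmem ht
      rw [hq, hs] at hy
      have : L.sndPiece j ((H t : ℝ) : Circ) = L.height j :=
        bump_coe_eq h0 (by linarith) (by rw [abs_le]; constructor <;> linarith [hy.1, hy.2])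
      rw [← hHk, this])
    (fun x hx y hy hxy => by
      have hx' := hmem hx
      have hy' := hmem hy
      have hxy' := hHm.monotone hxy
      rw [hp, hq] at hx' hy'
      simp only [← hHk]
      have : L.sndPiece j ((H x : ℝ) : Circ) ≤ L.sndPiece j ((H y : ℝ) : Circ) := by
        refine bump_coe_le_bump_coe h0 hh.le ?_ ?_
        · rw [abs_of_nonpos (by linarith [hy'.2]), abs_of_nonpos (by linarith [hx'.2])]
          linarith
        · rw [abs_of_nonpos (by linarith [hx'.2])]
          linarith [hx'.1]
      gcongr)
    (fun x hx y hy hxy => by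
      have hx' := hmem hx
      have hy' := hmem hy
      have hxy' := hHm.monotone hxy
      rw [hs, hw] at hx' hy'
      simp only [← hHk]
      have : L.sndPiece j ((H y : ℝ) : Circ) ≤ L.sndPiece j ((H x : ℝ) : Circ) := by
        refine bump_coe_le_bump_coe h0 hh.le ?_ ?_
        · rw [abs_of_nonneg (by linarith [hx'.1]), abs_of_nonneg (by linarith [hy'.1])]
          linarith
        · rw [abs_of_nonneg (by linarith [hy'.1])]
          linarith [hy'.2]
      gcongr)
    (fun t ht => by
      have hy := hmem ht
      rw [hp, hq] at hy
      rw [← hHk, L.fst_coe_eq_height hy])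
    (fun t ht => by
      have hy := hmem ht
      rw [hs, hw] at hy
      rw [← hHk, L.fst_coe_eq_zero hy])
    (half_pos hρ)
  filter_upwards [key] with ε hε
  have h3 : max (L.height j - ρ) 0 ^ 2 = (L.height j - 2 * (ρ / 2)) * max (L.height j - ρ) 0 := by
    rcases le_total (L.height j - ρ) 0 with h | h
    · simp [max_eq_right h]
    · rw [max_eq_left h]
      ring
  rw [h3]
  refine hε.trans_eq ?_
  have h4 := AddCircle.intervalIntegral_preimage (2 * Real.pi) (p - ε) fun t : Circ =>
    L.fst (k t) *
      (max (L.sndPiece j (k (t + (ε : Circ))) - ρ) 0 - max (L.sndPiece j (k t) - ρ) 0)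
  simp only [AddCircle.coe_add]
  rw [h4, AddCircle.integral_haarAddCircle, smul_eq_mul, ← mul_assoc,
    mul_inv_cancel₀ (by positivity), one_mul]

/-- If both coordinates of the reparametrized curve lie in `W_2^{1/2}`, the enclosed area
is bounded. -/
theorem exists_sum_sq_le {H : ℝ → ℝ} (hHm : StrictMono H) (hHs : Function.Surjective H)
    (hHp : ∀ x, H (x + 2 * Real.pi) = H x + 2 * Real.pi)
    {k : C(Circ, Circ)} (hHk : ∀ x : ℝ, ((H x : ℝ) : Circ) = k (x : Circ))
    (hc : Continuous L.fst) (hc' : Continuous L.snd)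
    (hfin : ∀ ρ > 0, {j | ρ < L.height j}.Finite)
    (hu : Summable fun n : ℤ => ‖fourierCoeff (fun t => (L.fst (k t) : ℂ)) n‖ ^ 2 * |(n : ℝ)|)
    (hv : Summable fun n : ℤ => ‖fourierCoeff (fun t => (L.snd (k t) : ℂ)) n‖ ^ 2 * |(n : ℝ)|) :
    ∃ M : ℝ, ∀ ρ > 0, ∀ S : Finset ι, ∑ j ∈ S, max (L.height j - ρ) 0 ^ 2 ≤ M := by
  refine ⟨2 * Real.pi * (∑' n : ℤ, ‖fourierCoeff (fun t => (L.fst (k t) : ℂ)) n‖ ^ 2 * |(n : ℝ)|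
    + 60 * ∑' n : ℤ, ‖fourierCoeff (fun t => (L.snd (k t) : ℂ)) n‖ ^ 2 * |(n : ℝ)|), ?_⟩
  intro ρ hρ S
  have hpi := Real.pi_pos
  classical
  set S' : Finset ι := S ∪ (hfin ρ hρ).toFinset
  have hS' : ∀ j ∉ S', ∀ t : Circ, max (L.sndPiece j t - ρ) 0 = 0 := by
    intro j hj t
    have h1 : L.height j ≤ ρ := by
      by_contra! h
      exact hj (Finset.mem_union_right _ ((hfin ρ hρ).mem_toFinset.2 h))
    have h2 : L.sndPiece j t ≤ L.height j := bump_le (L.height_pos j).le t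
    exact max_eq_right (by linarith)
  have hsum : ∀ t : Circ, max (L.snd t - ρ) 0 = ∑ j ∈ S', max (L.sndPiece j t - ρ) 0 :=
    fun t => apply_tsum_eq_sum (T := fun x => max (x - ρ) 0) L.sndPiece_disjoint
      (max_eq_right (by linarith)) hS' t
  set F : C(Circ, ℝ) := ⟨fun t => L.fst (k t), by fun_prop⟩
  set G : C(Circ, ℝ) := ⟨fun t => max (L.snd (k t) - ρ) 0, by fun_prop⟩
  set V : C(Circ, ℂ) := ⟨fun t => (L.snd (k t) : ℂ), by fun_prop⟩
  set Gc : C(Circ, ℂ) := ⟨fun t => (G t : ℂ), by fun_prop⟩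
  have hcontr : ∀ s t, ‖Gc s - Gc t‖ ≤ ‖V s - V t‖ := by
    intro s t
    simp only [Gc, V, G, ContinuousMap.coe_mk, ← Complex.ofReal_sub, Complex.norm_real,
      Real.norm_eq_abs]
    refine (abs_max_sub_max_le_abs _ _ _).trans_eq ?_
    congr 1
    ring
  have hGle := sum_sq_fourierCoeff_mul_abs_le hcontr hv
  have hG : Summable fun n : ℤ => ‖fourierCoeff Gc n‖ ^ 2 * |(n : ℝ)| :=
    summable_of_sum_le (fun n => by positivity) hGle
  have hGt : ∑' n : ℤ, ‖fourierCoeff Gc n‖ ^ 2 * |(n : ℝ)|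
      ≤ 60 * ∑' n : ℤ, ‖fourierCoeff V n‖ ^ 2 * |(n : ℝ)| := hG.tsum_le_of_sum_le hGle
  have hev : ∀ᶠ ε : ℝ in nhdsWithin (0 : ℝ) (Set.Ioi 0), ∀ j ∈ S',
      max (L.height j - ρ) 0 ^ 2 * ε ≤ 2 * Real.pi * ∫ t, L.fst (k t) *
        (max (L.sndPiece j (k (t + (ε : Circ))) - ρ) 0 - max (L.sndPiece j (k t) - ρ) 0)
          ∂AddCircle.haarAddCircle :=
    (Filter.eventually_all_finset S').2 fun j _ =>
      L.eventually_le_integral_piece hHm hHs hHp hHk hc hρ j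
  obtain ⟨ε, hε, hε0⟩ := (hev.and self_mem_nhdsWithin).exists
  have hInt : ∫ t, F t * (G (t + (ε : Circ)) - G t) ∂AddCircle.haarAddCircle
      = ∑ j ∈ S', ∫ t, L.fst (k t) *
        (max (L.sndPiece j (k (t + (ε : Circ))) - ρ) 0 - max (L.sndPiece j (k t) - ρ) 0)
          ∂AddCircle.haarAddCircle := by
    rw [← integral_finsetSum]
    · refine integral_congr_ae (Eventually.of_forall fun t => ?_)
      simp only [F, G, ContinuousMap.coe_mk, hsum]
      rw [← Finset.sum_sub_distrib, Finset.mul_sum]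
    · intro j _
      have hbc : Continuous (L.sndPiece j) := continuous_bump _ _ _
      exact Continuous.integrable_of_hasCompactSupport (by fun_prop)
        (HasCompactSupport.of_compactSpace _)
  have hA := (le_abs_self _).trans (abs_integral_mul_diff_le (f := F) (g := G) hu hG ε)
  rw [hInt, abs_of_pos hε0] at hA
  have hB := Finset.sum_le_sum hε
  rw [← Finset.sum_mul, ← Finset.mul_sum] at hB
  have hC : ∑ j ∈ S, max (L.height j - ρ) 0 ^ 2 ≤ ∑ j ∈ S', max (L.height j - ρ) 0 ^ 2 :=
    Finset.sum_le_sum_of_subset_of_nonneg Finset.subset_union_left fun _ _ _ => sq_nonneg _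
  refine hC.trans (le_of_mul_le_mul_right ?_ hε0)
  refine hB.trans ?_
  calc _ ≤ 2 * Real.pi * (ε * (∑' n : ℤ, ‖fourierCoeff (fun t => (F t : ℂ)) n‖ ^ 2 * |(n : ℝ)|
          + ∑' n : ℤ, ‖fourierCoeff (fun t => (G t : ℂ)) n‖ ^ 2 * |(n : ℝ)|)) := by gcongr
    _ ≤ 2 * Real.pi * (ε * (∑' n : ℤ, ‖fourierCoeff (fun t => (F t : ℂ)) n‖ ^ 2 * |(n : ℝ)|
          + 60 * ∑' n : ℤ, ‖fourierCoeff V n‖ ^ 2 * |(n : ℝ)|)) := by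
        gcongr
        exact hGt
    _ = _ := by
        simp only [F, V, ContinuousMap.coe_mk]
        ring

end LoopFamily

/-- Scales at which `ω` is much larger than the square root. -/
theorem exists_scales {ω : ℝ → ℝ} (hω : IsModulusOfContinuity ω)
    (hlimsup : ∀ M : ℝ, ∃ᶠ δ in nhdsWithin 0 (Set.Ioi 0), M < ω δ / Real.sqrt δ) (k : ℕ) :
    ∃ (d : ℝ) (n : ℕ), 0 < d ∧ 0 < ω d ∧ ω d ≤ (1 / 2) ^ k ∧ 4 * d * n ≤ (1 / 2) ^ k ∧
      (k : ℝ) ≤ n * ω d ^ 2 := by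
  have hl : (0 : ℝ) < (1 / 2) ^ k := by positivity
  set l : ℝ := (1 / 2) ^ k
  set M : ℝ := 8 * (k + 1) / l
  have hM : 0 < M := by positivity
  have h0 : Tendsto ω (nhdsWithin 0 (Set.Ioi 0)) (nhds 0) := by
    have := hω.1 0 (Set.mem_Ici.2 le_rfl)
    rw [ContinuousWithinAt, hω.2.2.1] at this
    exact this.mono_left (nhdsWithin_mono _ Set.Ioi_subset_Ici_self)
  obtain ⟨d, hdM, hd, hωd⟩ := ((hlimsup M).and_eventually
    ((show ∀ᶠ x in nhdsWithin (0 : ℝ) (Set.Ioi 0), x ∈ Set.Ioo 0 (l / 8) from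
      Ioo_mem_nhdsGT (by positivity)).and
      (h0.eventually_lt_const hl))).exists
  have hd0 : 0 < d := hd.1
  have hsq : 0 < Real.sqrt d := Real.sqrt_pos.2 hd0
  rw [lt_div_iff₀ hsq] at hdM
  have hM2 : M ^ 2 * d ≤ ω d ^ 2 := by
    calc M ^ 2 * d = (M * Real.sqrt d) ^ 2 := by rw [mul_pow, Real.sq_sqrt hd0.le]
      _ ≤ ω d ^ 2 := by gcongr
  refine ⟨d, ⌊l / (4 * d)⌋₊, hd0, (mul_pos hM hsq).trans hdM, hωd.le, ?_, ?_⟩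
  · have := Nat.floor_le (show 0 ≤ l / (4 * d) by positivity)
    rw [le_div_iff₀ (by positivity)] at this
    linarith
  · have h1 : l / (8 * d) ≤ ⌊l / (4 * d)⌋₊ := by
      have h2 := (Nat.lt_floor_add_one (l / (4 * d))).le
      have h3 : l / (4 * d) = l / (8 * d) + l / (8 * d) := by field_simp; norm_num
      have h4 : 1 ≤ l / (8 * d) := by
        rw [one_le_div (by positivity)]
        linarith [hd.2]
      linarith
    have hl1 : l ≤ 1 := pow_le_one₀ (by norm_num) (by norm_num)
    have hMk : (k : ℝ) + 1 ≤ M := by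
      rw [le_div_iff₀ hl]
      have : (0 : ℝ) ≤ k + 1 := by positivity
      nlinarith
    calc (k : ℝ) ≤ (k + 1) * M := by
          have : (0 : ℝ) ≤ k := by positivity
          nlinarith
      _ = l / (8 * d) * (M ^ 2 * d) := by
          simp only [M]
          field_simp
      _ ≤ ⌊l / (4 * d)⌋₊ * ω d ^ 2 := by gcongr

/-- Loop families whose coordinates have modulus of continuity `ω` and which enclose infinite
area. -/
theorem exists_loopFamily {ω : ℝ → ℝ} (hω : IsModulusOfContinuity ω)
    (hlimsup : ∀ M : ℝ, ∃ᶠ δ in nhdsWithin 0 (Set.Ioi 0), M < ω δ / Real.sqrt δ) :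
    ∃ (ι : Type) (L : LoopFamily ι), (∀ j, L.height j = ω (L.width j)) ∧
      (∀ ρ > 0, {j | ρ < L.height j}.Finite) ∧
      ∀ M : ℝ, ∃ ρ > 0, ∃ S : Finset ι, M < ∑ j ∈ S, max (L.height j - ρ) 0 ^ 2 := by
  choose d n hd hωd hωk hn hk using exists_scales hω hlimsup
  have hfit : ∀ j : Σ k, Fin (n k), (1 / 2 : ℝ) ^ j.1 + 4 * d j.1 * j.2 + 4 * d j.1
      ≤ 2 * (1 / 2 : ℝ) ^ j.1 := by
    rintro ⟨k, i⟩
    have h1 : ((i : ℕ) : ℝ) + 1 ≤ n k := by exact_mod_cast i.2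
    have h2 : 4 * d k * (((i : ℕ) : ℝ) + 1) ≤ 4 * d k * n k := by
      have := hd k
      gcongr
    dsimp only
    linarith [hn k]
  have hpow : ∀ a b : ℕ, a < b → 2 * (1 / 2 : ℝ) ^ b ≤ (1 / 2) ^ a := by
    intro a b hab
    have h1 : (1 / 2 : ℝ) ^ b ≤ (1 / 2) ^ (a + 1) :=
      pow_le_pow_of_le_one (by norm_num) (by norm_num) hab
    rw [pow_succ] at h1
    linarith
  have hnn : ∀ (k : ℕ) (i : Fin (n k)), 0 ≤ 4 * d k * ((i : ℕ) : ℝ) := fun k i => by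
    have := hd k
    positivity
  refine ⟨Σ k, Fin (n k), ⟨fun j => (1 / 2) ^ j.1 + 4 * d j.1 * j.2, fun j => d j.1,
    fun j => ω (d j.1), fun j => hd _, fun j => hωd _, fun j => ?_, fun j => ?_, ?_⟩,
    fun j => rfl, fun ρ hρ => ?_, fun M => ?_⟩
  · have := hd j.1
    positivity
  · have h1 : (1 / 2 : ℝ) ^ j.1 ≤ 1 := pow_le_one₀ (by norm_num) (by norm_num)
    linarith [hfit j, Real.pi_gt_three]
  · rintro ⟨k, i⟩ ⟨k', i'⟩ hne
    rcases lt_trichotomy k k' with h | rfl | h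
    · right
      exact (hfit ⟨k', i'⟩).trans ((hpow _ _ h).trans (le_add_of_nonneg_right (hnn k i)))
    · have hii : (i : ℕ) ≠ i' := fun h => hne (by rw [Fin.ext h])
      have hstep : ∀ a b : ℕ, a < b → 4 * d k * (a : ℝ) + 4 * d k ≤ 4 * d k * b := by
        intro a b hab
        have h1 : (a : ℝ) + 1 ≤ b := by exact_mod_cast hab
        have := hd k
        calc 4 * d k * (a : ℝ) + 4 * d k = 4 * d k * (a + 1) := by ring
          _ ≤ 4 * d k * b := by gcongr
      rcases lt_or_gt_of_ne hii with h | h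
      · left
        dsimp only
        linarith [hstep _ _ h]
      · right
        dsimp only
        linarith [hstep _ _ h]
    · left
      exact (hfit ⟨k, i⟩).trans ((hpow _ _ h).trans (le_add_of_nonneg_right (hnn k' i')))
  · obtain ⟨N, hN⟩ := exists_pow_lt_of_lt_one hρ (show (1 / 2 : ℝ) < 1 by norm_num)
    refine ((Finset.range N).sigma fun k => (Finset.univ : Finset (Fin (n k)))).finite_toSet.subset
      fun j hj => ?_
    simp only [Finset.coe_sigma, Set.mem_sigma_iff, Finset.coe_range, Set.mem_Iio,
      Finset.coe_univ, Set.mem_univ, and_true]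
    by_contra! h
    have h1 : (1 / 2 : ℝ) ^ j.1 ≤ (1 / 2) ^ N :=
      pow_le_pow_of_le_one (by norm_num) (by norm_num) h
    have h2 : ρ < ω (d j.1) := hj
    linarith [hωk j.1]
  · obtain ⟨k, hkM⟩ := exists_nat_gt (4 * M)
    refine ⟨ω (d k) / 2, half_pos (hωd k),
      Finset.univ.map (Function.Embedding.sigmaMk (β := fun k => Fin (n k)) k), ?_⟩
    rw [Finset.sum_map]
    simp only [Function.Embedding.sigmaMk_apply, Finset.sum_const, Finset.card_univ,
      Fintype.card_fin, nsmul_eq_mul]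
    rw [sub_half, max_eq_left (half_pos (hωd k)).le]
    linarith [hk k]

/-- Suppose `ω` is a modulus of continuity with `limsup_{δ→0+} ω(δ)/√δ = ∞`. Then there exist
real-valued `u, v ∈ Lip_ω(𝕋)` such that for every homeomorphism `h` of the circle, at least one
of `u ∘ h`, `v ∘ h` does not belong to `W_2^{1/2}(𝕋)`. -/
theorem bohrPal_two_real_LipOmega_not_W_half (ω : ℝ → ℝ) (hω : IsModulusOfContinuity ω)
    (hlimsup : ∀ M : ℝ, ∃ᶠ δ in nhdsWithin 0 (Set.Ioi 0), M < ω δ / Real.sqrt δ) :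
    ∃ u v : AddCircle (2 * Real.pi) → ℝ,
      (∃ C : ℝ, ∀ t₁ t₂ : AddCircle (2 * Real.pi), |u t₁ - u t₂| ≤ C * ω (dist t₁ t₂)) ∧
      (∃ C : ℝ, ∀ t₁ t₂ : AddCircle (2 * Real.pi), |v t₁ - v t₂| ≤ C * ω (dist t₁ t₂)) ∧
      ∀ h : AddCircle (2 * Real.pi) ≃ₜ AddCircle (2 * Real.pi),
        ¬ Summable (fun k : ℤ => ‖fourierCoeff (fun t => (u (h t) : ℂ)) k‖ ^ 2 * |(k : ℝ)|) ∨
        ¬ Summable (fun k : ℤ => ‖fourierCoeff (fun t => (v (h t) : ℂ)) k‖ ^ 2 * |(k : ℝ)|) := by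
  obtain ⟨ι, L, hL, hfin, harea⟩ := exists_loopFamily hω hlimsup
  have hu := L.abs_fst_sub_le hω hL
  have hv := L.abs_snd_sub_le hω hL
  have huc := hω.continuous_of_abs_sub_le hu
  have hvc := hω.continuous_of_abs_sub_le hv
  refine ⟨L.fst, L.snd, ⟨4, hu⟩, ⟨4, hv⟩, fun h => ?_⟩
  by_contra! hcon
  obtain ⟨hsu, hsv⟩ := hcon
  obtain ⟨σ, H, hσ, hHm, hHs, hHp, hHh⟩ := exists_strictMono_lift h
  have key : ∀ k : C(Circ, Circ), (∀ x : ℝ, ((H x : ℝ) : Circ) = k (x : Circ)) →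
      (Summable fun n : ℤ => ‖fourierCoeff (fun t => (L.fst (k t) : ℂ)) n‖ ^ 2 * |(n : ℝ)|) →
      (Summable fun n : ℤ => ‖fourierCoeff (fun t => (L.snd (k t) : ℂ)) n‖ ^ 2 * |(n : ℝ)|) →
      False := by
    intro k hk h1 h2
    obtain ⟨M, hM⟩ := L.exists_sum_sq_le hHm hHs hHp hk huc hvc hfin h1 h2
    obtain ⟨ρ, hρ, S, hS⟩ := harea M
    exact absurd (hM ρ hρ S) (not_le.2 hS)
  rcases hσ with rfl | rfl
  · exact key ⟨h, h.continuous⟩ (fun x => by simpa using hHh x) hsu hsv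
  · have h1 := summable_sq_fourierCoeff_comp_neg (fun t => (L.fst (h t) : ℂ)) hsu
    have h2 := summable_sq_fourierCoeff_comp_neg (fun t => (L.snd (h t) : ℂ)) hsv
    exact key ⟨fun t => h (-t), h.continuous.comp continuous_neg⟩
      (fun x => by simpa using hHh x) h1 h2
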